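/- For all integers n and r, and complex q with |q| < 1: sum_{L >= 0} ( [2L+r choose L+n]_q - [2L+r choose L+n-1]_q ) / ((q;q)_L (q;q)_{L+r}) = (q;q)_inf^{-1} sum_{j >= 0} ( q^j / ((q;q)_j (q;q)_{j-n}) - q^j / ((q;q)_j (q;q)_{j+n-r-1}) ). -/

import Mathlib

open scoped BigOperators

noncomputable section

/-- Finite q-Pochhammer symbol `(a;q)_n`. -/
def qP (q a : ℂ) (n : ℕ) : ℂ := ∏ m ∈ Finset.range n, (1 - a * q ^ m)

/-- Infinite q-Pochhammer symbol `(a;q)_∞`. -/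
def qPInf (q a : ℂ) : ℂ := ∏' m : ℕ, (1 - a * q ^ m)

/-- `1/(q;q)_n` for `n : ℤ`, equal to `0` for negative `n`. -/
def invQ (q : ℂ) (n : ℤ) : ℂ := if 0 ≤ n then (qP q q n.toNat)⁻¹ else 0

/-- q-binomial coefficient `[n choose m]_q`, zero unless `0 ≤ m ≤ n`. -/
def qBinI (q : ℂ) (n m : ℤ) : ℂ :=
  if 0 ≤ m ∧ m ≤ n then
    qP q q n.toNat * ((qP q q m.toNat)⁻¹ * (qP q q (n - m).toNat)⁻¹)
  else 0

def uu (q : ℂ) (m : ℤ) : ℂ := q ^ m.toNat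

lemma one_sub_ne {q : ℂ} (hq : ‖q‖ < 1) (m : ℕ) : 1 - q * q ^ m ≠ 0 := by
  intro h
  have h1 : q ^ (m+1) = 1 := by rw [pow_succ']; linear_combination -h
  have h2 : ‖q‖ ^ (m+1) = 1 := by rw [← norm_pow, h1, norm_one]
  have := pow_lt_one₀ (norm_nonneg q) hq (Nat.succ_ne_zero m)
  simp only [Nat.succ_eq_add_one] at this
  linarith

lemma qP_ne {q : ℂ} (hq : ‖q‖ < 1) (m : ℕ) : qP q q m ≠ 0 := by
  unfold qP
  exact Finset.prod_ne_zero_iff.mpr fun i _ => one_sub_ne hq i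

lemma qP_succ (q : ℂ) (m : ℕ) : qP q q (m+1) = qP q q m * (1 - q ^ (m+1)) := by
  unfold qP
  rw [Finset.prod_range_succ, pow_succ' q m]

lemma invQ_neg (q : ℂ) {m : ℤ} (h : m < 0) : invQ q m = 0 := by
  unfold invQ; rw [if_neg (by omega)]

lemma invQ_nat (q : ℂ) (m : ℕ) : invQ q (m : ℤ) = (qP q q m)⁻¹ := by
  unfold invQ; rw [if_pos (by omega)]; simp

lemma invQ_pred {q : ℂ} (hq : ‖q‖ < 1) (m : ℤ) : invQ q (m - 1) = (1 - uu q m) * invQ q m := by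
  rcases lt_trichotomy m 0 with h | h | h
  · rw [invQ_neg q h, invQ_neg q (by omega)]; simp
  · subst h; rw [invQ_neg q (by omega)]; simp [uu]
  · obtain ⟨k, rfl⟩ : ∃ k : ℕ, m = ((k+1 : ℕ) : ℤ) := ⟨(m-1).toNat, by omega⟩
    have e : ((k+1 : ℕ) : ℤ) - 1 = (k : ℤ) := by push_cast; ring
    have h1 := qP_ne hq k
    have h2 := qP_ne hq (k+1)
    rw [e, invQ_nat, invQ_nat]
    unfold uu
    rw [Int.toNat_natCast]
    rw [eq_mul_inv_iff_mul_eq₀ h2, qP_succ]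
    field_simp

lemma uu_mul (q : ℂ) (a b : ℤ) :
    uu q a * uu q b * (invQ q a * invQ q b) = uu q (a+b) * (invQ q a * invQ q b) := by
  by_cases ha : a < 0
  · simp [invQ_neg q ha]
  by_cases hb : b < 0
  · simp [invQ_neg q hb]
  unfold uu
  rw [Int.toNat_add (by omega) (by omega), pow_add]

/-- normalized binomial -/
def bet (q : ℂ) (n p : ℤ) : ℂ := invQ q p * invQ q (n - p)

lemma bet_neg (q : ℂ) {n : ℤ} (h : n < 0) (p : ℤ) : bet q n p = 0 := by
  unfold bet
  by_cases hp : p < 0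
  · simp [invQ_neg q hp]
  · rw [invQ_neg q (show n - p < 0 by omega)]; simp

lemma qBinI_eq (q : ℂ) (n p : ℤ) : qBinI q n p = qP q q n.toNat * bet q n p := by
  unfold qBinI bet
  by_cases hp : p < 0
  · rw [if_neg (by omega), invQ_neg q hp]; simp
  by_cases hn : n - p < 0
  · rw [if_neg (by omega), invQ_neg q hn]; simp
  rw [if_pos (by omega)]
  unfold invQ
  rw [if_pos (by omega), if_pos (by omega)]

lemma bet_rec {q : ℂ} (hq : ‖q‖ < 1) (n p : ℤ) :
    (1 - uu q (n+1)) * bet q (n+1) p = bet q n p + bet q n (p-1) - bet q (n-1) (p-1) := by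
  unfold bet
  have e1 : n - p = (n + 1 - p) - 1 := by ring
  have e2 : n - (p - 1) = n + 1 - p := by ring
  have e3 : n - 1 - (p - 1) = (n + 1 - p) - 1 := by ring
  rw [e2, e3, e1, invQ_pred hq, invQ_pred hq]
  have := uu_mul q p (n + 1 - p)
  rw [show p + (n + 1 - p) = n + 1 by ring] at this
  linear_combination this

lemma bin_rec {q : ℂ} (hq : ‖q‖ < 1) (s : ℤ) (hs : 0 ≤ s) (p : ℤ) :
    qBinI q s p + qBinI q s (p-1) = qBinI q (s+1) p + (1 - uu q s) * qBinI q (s-1) (p-1) := by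
  simp only [qBinI_eq]
  have h := bet_rec hq s p
  have h1 : qP q q (s+1).toNat = qP q q s.toNat * (1 - uu q (s+1)) := by
    obtain ⟨k, rfl⟩ := Int.eq_ofNat_of_zero_le hs
    unfold uu
    rw [show ((k:ℤ)+1).toNat = k + 1 by omega, qP_succ]; simp
  have h2 : (1 - uu q s) * qP q q (s-1).toNat * bet q (s-1) (p-1)
      = qP q q s.toNat * bet q (s-1) (p-1) := by
    by_cases h0 : s = 0
    · rw [bet_neg q (by omega)]; simp
    · obtain ⟨k, rfl⟩ : ∃ k : ℕ, s = ((k+1 : ℕ) : ℤ) := ⟨(s-1).toNat, by omega⟩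
      unfold uu
      rw [show (((k+1:ℕ):ℤ)-1).toNat = k by omega, Int.toNat_natCast, qP_succ]; ring
  rw [h1]
  linear_combination (- qP q q s.toNat) * h - h2

def ee (q : ℂ) (M N k : ℤ) : ℂ := invQ q k * (invQ q (M - k) * invQ q (N - k))

lemma ee_rec {q : ℂ} (hq : ‖q‖ < 1) (M N k : ℤ) :
    (1 - uu q (N+1)) * ee q M (N+1) (k+1)
      = ee q M N (k+1) + (1 - uu q (M + N - 2*k)) * ee q M N k - ee q M (N-1) k := by
  unfold ee
  have a1 : invQ q k = (1 - uu q (k+1)) * invQ q (k+1) := by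
    rw [← invQ_pred hq]; congr 1; ring
  have a2 : invQ q (M - (k+1)) = (1 - uu q (M-k)) * invQ q (M-k) := by
    rw [← invQ_pred hq]; congr 1; ring
  have a3 : invQ q (N - (k+1)) = (1 - uu q (N-k)) * invQ q (N-k) := by
    rw [← invQ_pred hq]; congr 1; ring
  have a4 : invQ q (N - 1 - k) = (1 - uu q (N-k)) * invQ q (N-k) := by
    rw [← invQ_pred hq]; congr 1; ring
  have a5 : N + 1 - (k+1) = N - k := by ring
  rw [a5, a4, a3, a2, a1]
  have h1 := uu_mul q (k+1) (N-k)
  have h2 := uu_mul q (M-k) (N-k)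
  rw [show k + 1 + (N-k) = N+1 by ring] at h1
  rw [show M-k + (N-k) = M+N-2*k by ring] at h2
  linear_combination ((1 - uu q (M-k)) * invQ q (M-k)) * h1 - ((1 - uu q (k+1)) * invQ q (k+1)) * h2

def AA (q : ℂ) (M : ℕ) (N p : ℤ) : ℂ :=
  ∑ i ∈ Finset.range (M+1), bet q M i * bet q N (p - i)

def BB (q : ℂ) (M : ℕ) (N p : ℤ) : ℂ :=
  ∑ k ∈ Finset.range (M+1), ee q M N k * qBinI q (M + N - 2 * k) (p - k)

lemma AA_rec {q : ℂ} (hq : ‖q‖ < 1) (M : ℕ) (N p : ℤ) :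
    (1 - uu q (N+1)) * AA q M (N+1) p = AA q M N p + AA q M N (p-1) - AA q M (N-1) (p-1) := by
  unfold AA
  rw [Finset.mul_sum, ← Finset.sum_add_distrib, ← Finset.sum_sub_distrib]
  refine Finset.sum_congr rfl fun i _ => ?_
  have h := bet_rec hq N (p - i)
  rw [show p - 1 - (i:ℤ) = p - i - 1 by ring]
  linear_combination bet q M i * h

lemma BB_rec {q : ℂ} (hq : ‖q‖ < 1) (M : ℕ) (N p : ℤ) :
    (1 - uu q (N+1)) * BB q M (N+1) p = BB q M N p + BB q M N (p-1) - BB q M (N-1) (p-1) := by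
  have key : BB q M N p + BB q M N (p-1) - BB q M (N-1) (p-1)
      = ∑ k ∈ Finset.range (M+1), (ee q M N k * qBinI q (M + (N + 1) - 2 * k) (p - k) +
        ((1 - uu q (M + N - 2*k)) * ee q M N k - ee q M (N-1) k) *
          qBinI q (M + (N+1) - 2 * ((k+1 : ℕ) : ℤ)) (p - ((k+1 : ℕ) : ℤ))) := by
    unfold BB
    rw [← Finset.sum_add_distrib, ← Finset.sum_sub_distrib]
    refine Finset.sum_congr rfl fun k hk => ?_
    have hkM : k ≤ M := by simpa [Nat.lt_succ_iff] using hk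
    rw [show p - 1 - (k:ℤ) = p - k - 1 by ring, show (p - ((k+1 : ℕ) : ℤ)) = p - k - 1 by push_cast; ring,
      show (M + (N+1) - 2 * ((k+1 : ℕ) : ℤ)) = M + N - 2*k - 1 by push_cast; ring,
      show (M + (N+1) - 2 * (k : ℤ)) = M + N - 2*k + 1 by ring,
      show (M + (N-1) - 2 * (k : ℤ)) = M + N - 2*k - 1 by ring]
    by_cases hN : N - k < 0
    · have z : ee q M N k = 0 := by unfold ee; rw [invQ_neg q hN]; simp
      rw [z]; ring
    · have h := bin_rec hq (M + N - 2*k) (by omega) (p - k)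
      linear_combination ee q M N k * h
  rw [key, Finset.sum_add_distrib]
  have h1 : ∀ F : ℕ → ℂ, ∑ k ∈ Finset.range (M+1), ee q M N k * F k
      = ee q M N 0 * F 0 + ∑ k ∈ Finset.range (M+1), ee q M N ((k+1 : ℕ) : ℤ) * F (k+1) := by
    intro F
    rw [Finset.sum_range_succ', Finset.sum_range_succ (n := M)]
    have z : ee q M N ((M+1 : ℕ) : ℤ) = 0 := by
      unfold ee; rw [invQ_neg q (show (M:ℤ) - ((M+1 : ℕ) : ℤ) < 0 by omega)]; simp
    rw [z]; simp; ring
  have h2 : BB q M (N+1) p = ee q M (N+1) 0 * qBinI q (M + (N+1) - 2 * ((0:ℕ):ℤ)) (p - ((0:ℕ):ℤ)) +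
      ∑ k ∈ Finset.range (M+1), ee q M (N+1) ((k+1 : ℕ) : ℤ) *
        qBinI q (M + (N+1) - 2 * ((k+1 : ℕ) : ℤ)) (p - ((k+1 : ℕ) : ℤ)) := by
    unfold BB
    rw [Finset.sum_range_succ', Finset.sum_range_succ (n := M)]
    have z : ee q M (N+1) ((M+1 : ℕ) : ℤ) = 0 := by
      unfold ee; rw [invQ_neg q (show (M:ℤ) - ((M+1 : ℕ) : ℤ) < 0 by omega)]; simp
    rw [z]; simp; ring
  rw [h1 (fun k => qBinI q (M + (N + 1) - 2 * (k:ℤ)) (p - (k:ℤ))), h2, mul_add, add_assoc,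
    ← Finset.sum_add_distrib, Finset.mul_sum]
  congr 1
  · have : (1 - uu q (N+1)) * ee q M (N+1) 0 = ee q M N 0 := by
      unfold ee
      have := invQ_pred hq (N+1)
      rw [show N + 1 - 1 = N by ring] at this
      simp only [sub_zero]
      rw [this]; ring
    rw [← this]; ring
  · refine Finset.sum_congr rfl fun k _ => ?_
    have h := ee_rec hq M N k
    push_cast
    linear_combination qBinI q (M + (N+1) - 2 * ((k:ℤ)+1)) (p - ((k:ℤ)+1)) * h

lemma AA_eq_BB {q : ℂ} (hq : ‖q‖ < 1) (M : ℕ) (N : ℕ) :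
    ∀ p, AA q M ((N:ℤ) - 1) p = BB q M ((N:ℤ) - 1) p := by
  induction N using Nat.twoStepInduction with
  | zero =>
    intro p
    unfold AA BB
    refine (Finset.sum_eq_zero fun i _ => ?_).trans (Finset.sum_eq_zero fun i _ => ?_).symm
    · rw [bet_neg q (show ((0:ℕ):ℤ) - 1 < 0 by omega)]; simp
    · unfold ee; rw [invQ_neg q (show ((0:ℕ):ℤ) - 1 - (i:ℤ) < 0 by omega)]; simp
  | one =>
    intro p
    have hb : ∀ x : ℤ, bet q 0 x = if x = 0 then 1 else 0 := by
      intro x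
      unfold bet
      split_ifs with h
      · subst h; simp [invQ, qP]
      · by_cases hx : x < 0
        · rw [invQ_neg q hx]; simp
        · rw [invQ_neg q (show 0 - x < 0 by omega)]; simp
    have hB : BB q M ((1:ℕ) - 1) p = bet q M p := by
      unfold BB
      rw [Finset.sum_range_succ', Finset.sum_eq_zero]
      · simp only [ee, qBinI_eq]
        have := qP_ne hq M
        have h0 : invQ q 0 = 1 := by simp [invQ, qP]
        simp [h0, invQ_nat]
        field_simp
      · intro k _
        unfold ee
        rw [invQ_neg q (show ((1:ℕ):ℤ) - 1 - ((k+1:ℕ):ℤ) < 0 by omega)]; simp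
    rw [hB]
    unfold AA
    simp only [Nat.cast_one, sub_self, hb]
    by_cases hp : 0 ≤ p ∧ p ≤ M
    · rw [Finset.sum_eq_single p.toNat]
      · rw [Int.toNat_of_nonneg hp.1]; simp
      · intro b _ hb'
        rw [if_neg (by omega)]; simp
      · intro h; exact absurd (Finset.mem_range.mpr (by omega)) h
    · rw [Finset.sum_eq_zero]
      · unfold bet
        by_cases h0 : p < 0
        · rw [invQ_neg q h0]; simp
        · rw [invQ_neg q (show (M:ℤ) - p < 0 by omega)]; simp
      · intro i hi
        have := Finset.mem_range.mp hi
        rw [if_neg (by omega)]; simp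
  | more n ih1 ih2 =>
    intro p
    have hA := AA_rec hq M n p
    have hB := BB_rec hq M n p
    have e : ((n+1:ℕ):ℤ) - 1 = n := by push_cast; ring
    rw [e] at ih2
    rw [ih1, ih2, ih2, ← hB] at hA
    have e2 : ((n+2:ℕ):ℤ) - 1 = n + 1 := by push_cast; ring
    rw [e2]
    refine mul_left_cancel₀ ?_ hA
    have := one_sub_ne hq n
    unfold uu
    rw [show ((n:ℤ)+1).toNat = n+1 by omega, pow_succ']
    exact this

open Filter Topology

lemma qP_tend {q : ℂ} (hq : ‖q‖ < 1) : Tendsto (fun n => qP q q n) atTop (𝓝 (qPInf q q)) := by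
  have hs : Summable (fun m : ℕ => ‖-(q * q ^ m)‖) := by
    simp only [norm_neg, norm_mul, norm_pow]
    exact (summable_geometric_of_lt_one (norm_nonneg q) hq).mul_left _
  have := (multipliable_one_add_of_summable hs).tendsto_prod_tprod_nat
  simp only [← sub_eq_add_neg] at this
  exact this

lemma qPInf_ne {q : ℂ} (hq : ‖q‖ < 1) : qPInf q q ≠ 0 := by
  have hs : Summable (fun m : ℕ => ‖-(q * q ^ m)‖) := by
    simp only [norm_neg, norm_mul, norm_pow]
    exact (summable_geometric_of_lt_one (norm_nonneg q) hq).mul_left _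
  have := tprod_one_add_ne_zero_of_summable (f := fun m : ℕ => -(q * q ^ m))
    (fun i => by rw [← sub_eq_add_neg]; exact one_sub_ne hq i) hs
  simp only [← sub_eq_add_neg] at this
  exact this

lemma inv_tend {q : ℂ} (hq : ‖q‖ < 1) :
    Tendsto (fun n => (qP q q n)⁻¹) atTop (𝓝 (qPInf q q)⁻¹) := (qP_tend hq).inv₀ (qPInf_ne hq)

lemma invQ_tend {q : ℂ} (hq : ‖q‖ < 1) (s : ℤ) :
    Tendsto (fun L : ℕ => invQ q ((L:ℤ) + s)) atTop (𝓝 (qPInf q q)⁻¹) := by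
  have h1 : Tendsto (fun L : ℕ => ((L:ℤ) + s).toNat) atTop atTop := by
    refine tendsto_atTop.mpr fun b => ?_
    filter_upwards [eventually_ge_atTop (b + s.natAbs)] with L hL
    omega
  refine ((inv_tend hq).comp h1).congr' ?_
  filter_upwards [eventually_ge_atTop (s.natAbs)] with L hL
  unfold invQ
  rw [if_pos (by omega)]; rfl

lemma seq_bd {f : ℕ → ℂ} {x : ℂ} (h : Tendsto f atTop (𝓝 x)) : ∃ K, 0 ≤ K ∧ ∀ n, ‖f n‖ ≤ K := by
  obtain ⟨K, hK⟩ := (Metric.isBounded_range_of_tendsto f h).exists_norm_le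
  exact ⟨K, (norm_nonneg _).trans (hK (f 0) ⟨0, rfl⟩), fun n => hK _ ⟨n, rfl⟩⟩

lemma invQ_bd {q : ℂ} (hq : ‖q‖ < 1) : ∃ K, 0 ≤ K ∧ ∀ m, ‖invQ q m‖ ≤ K := by
  obtain ⟨K, h0, hK⟩ := seq_bd (inv_tend hq)
  refine ⟨K, h0, fun m => ?_⟩
  unfold invQ
  split_ifs
  · exact hK _
  · simpa using h0

lemma summ_u {q : ℂ} (hq : ‖q‖ < 1) (s : ℤ) : Summable (fun i : ℕ => ‖uu q (s + i)‖) := by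
  rw [← summable_nat_add_iff s.natAbs]
  refine Summable.of_nonneg_of_le (fun _ => norm_nonneg _) (fun i => ?_)
    (summable_geometric_of_lt_one (norm_nonneg q) hq)
  unfold uu
  rw [norm_pow]
  exact pow_le_pow_of_le_one (norm_nonneg q) hq.le (by omega)

def GTerm (q : ℂ) (s : ℤ) (i : ℕ) : ℂ := invQ q i * invQ q (s + i) * uu q (s + i)

lemma GTerm_summable {q : ℂ} (hq : ‖q‖ < 1) (s : ℤ) : Summable (GTerm q s) := by
  obtain ⟨K, h0, hK⟩ := invQ_bd hq
  refine Summable.of_norm_bounded ((summ_u hq s).mul_left (K * K)) fun i => ?_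
  unfold GTerm
  rw [norm_mul, norm_mul]
  gcongr <;> apply hK

lemma T_tend {q : ℂ} (hq : ‖q‖ < 1) (s t : ℤ) :
    Tendsto (fun L : ℕ => ∑ i ∈ Finset.range (L+1),
      invQ q i * invQ q ((L:ℤ) - i) * invQ q (s + i) * invQ q ((L:ℤ) + t - i) * uu q (s + i)) atTop
      (𝓝 ((qPInf q q)⁻¹ * (qPInf q q)⁻¹ * ∑' i, GTerm q s i)) := by
  obtain ⟨K, h0, hK⟩ := invQ_bd hq
  rw [← tsum_mul_left]
  have := tendsto_tsum_of_dominated_convergence (𝓕 := atTop)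
    (f := fun (L : ℕ) (i : ℕ) =>
      invQ q i * invQ q ((L:ℤ) - i) * invQ q (s + i) * invQ q ((L:ℤ) + t - i) * uu q (s + i))
    (g := fun i => (qPInf q q)⁻¹ * (qPInf q q)⁻¹ * GTerm q s i)
    (bound := fun i : ℕ => K * K * K * K * ‖uu q (s + i)‖)
    ((summ_u hq s).mul_left _) ?_ ?_
  · refine this.congr fun L => ?_
    refine tsum_eq_sum fun i hi => ?_
    rw [invQ_neg q (show (L:ℤ) - i < 0 by simp at hi; omega)]; simp
  · intro i
    have h1 := invQ_tend hq (-(i:ℤ))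
    have h2 := invQ_tend hq (t - i)
    have h3 := (h1.mul h2).mul_const (GTerm q s i)
    refine h3.congr fun L => ?_
    unfold GTerm
    rw [← sub_eq_add_neg, ← add_sub_assoc]
    ring
  · refine Eventually.of_forall fun L i => ?_
    simp only [norm_mul]
    gcongr <;> apply hK

lemma GTerm_tsum (q : ℂ) (s : ℤ) : ∑' i, GTerm q s i
    = ∑' j : ℕ, q ^ j * ((qP q q j)⁻¹ * invQ q ((j:ℤ) - s)) := by
  let f : ℤ → ℂ := fun i => invQ q i * invQ q (s + i) * uu q (s + i)
  have hA : ∑' i, GTerm q s i = ∑' z : ℤ, f z := by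
    refine Function.Injective.tsum_eq (g := fun i : ℕ => (i:ℤ)) Nat.cast_injective (f := f) ?_
    intro z hz
    by_contra hcon
    apply hz
    have : z < 0 := by
      by_contra h; exact hcon ⟨z.toNat, by simp; omega⟩
    simp only [f]; rw [invQ_neg q this]; simp
  have hB : ∑' j : ℕ, q ^ j * ((qP q q j)⁻¹ * invQ q ((j:ℤ) - s)) = ∑' z : ℤ, f (z - s) := by
    rw [← Function.Injective.tsum_eq (g := fun i : ℕ => (i:ℤ)) Nat.cast_injective (f := fun z => f (z - s))]
    · refine tsum_congr fun j => ?_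
      simp only [f]
      rw [show s + ((j:ℤ) - s) = j by ring, invQ_nat]
      unfold uu
      rw [Int.toNat_natCast]; ring
    · intro z hz
      by_contra hcon
      apply hz
      have : z < 0 := by
        by_contra h; exact hcon ⟨z.toNat, by simp; omega⟩
      simp only [f]; rw [show s + (z - s) = z by ring, invQ_neg q this]; simp
  rw [hA, hB]
  exact ((Equiv.subRight s).tsum_eq f).symm

lemma RT_summable {q : ℂ} (hq : ‖q‖ < 1) (s : ℤ) :
    Summable (fun j : ℕ => q ^ j * ((qP q q j)⁻¹ * invQ q ((j:ℤ) - s))) := by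
  obtain ⟨K, h0, hK⟩ := invQ_bd hq
  refine Summable.of_norm_bounded
    ((summable_geometric_of_lt_one (norm_nonneg q) hq).mul_right (K * K)) fun i => ?_
  rw [norm_mul, norm_mul, norm_pow, ← invQ_nat]
  gcongr <;> apply hK

/-- the summand on the left -/
def CC (q : ℂ) (n r : ℤ) (L : ℕ) : ℂ :=
  (qBinI q (2 * (L : ℤ) + r) ((L : ℤ) + n) - qBinI q (2 * (L : ℤ) + r) ((L : ℤ) + n - 1)) *
        ((qP q q L)⁻¹ * invQ q ((L : ℤ) + r))

lemma bet_diff {q : ℂ} (hq : ‖q‖ < 1) (n p : ℤ) :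
    bet q n p - bet q n (p-1) = invQ q p * invQ q (n - p + 1) * (uu q p - uu q (n - p + 1)) := by
  unfold bet
  have := invQ_pred hq (n - p + 1)
  rw [show n - p + 1 - 1 = n - p by ring] at this
  rw [invQ_pred hq p, this, show n - (p - 1) = n - p + 1 by ring]
  ring

lemma CC_summable {q : ℂ} (hq : ‖q‖ < 1) (n r : ℤ) : Summable (CC q n r) := by
  obtain ⟨K, h0, hK⟩ := invQ_bd hq
  obtain ⟨K', h0', hK'⟩ := seq_bd (qP_tend hq)
  refine Summable.of_norm_bounded
    (((summ_u hq n).add (summ_u hq (r - n + 1))).mul_left (K' * (K * K) * (K * K))) fun L => ?_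
  unfold CC
  rw [qBinI_eq, qBinI_eq, ← mul_sub, bet_diff hq, ← invQ_nat,
    show 2 * (L:ℤ) + r - (L + n) + 1 = r - n + 1 + L by ring, add_comm (L:ℤ) n]
  have h3 := norm_sub_le (uu q (n + L)) (uu q (r - n + 1 + L))
  calc _ = ‖qP q q (2 * (L:ℤ) + r).toNat‖ * (‖invQ q (n + L)‖ * ‖invQ q (r - n + 1 + L)‖)
      * (‖invQ q L‖ * ‖invQ q (L + r)‖) * ‖uu q (n + L) - uu q (r - n + 1 + L)‖ := by
        simp only [norm_mul]; ring
    _ ≤ _ := by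
        gcongr <;> first | apply hK | apply hK'

lemma conv_eq {q : ℂ} (hq : ‖q‖ < 1) (n r : ℤ) (L : ℕ) (hL : 0 ≤ (L:ℤ) + r) :
    AA q L (L + r) (L + n) - AA q L (L + r) (L + n - 1)
      = ∑ k ∈ Finset.range (L+1), invQ q ((L:ℤ) - k) * CC q n r k := by
  have h : ∀ p, AA q L (L + r) p = BB q L (L + r) p := by
    intro p
    have := AA_eq_BB hq L (L + r + 1).toNat p
    rwa [show (((L + r + 1).toNat : ℕ) : ℤ) - 1 = L + r by omega] at this
  rw [h, h]
  unfold BB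
  rw [← Finset.sum_sub_distrib, ← Finset.sum_range_reflect]
  refine Finset.sum_congr rfl fun k hk => ?_
  have hk' : k ≤ L := by simpa [Nat.lt_succ_iff] using hk
  rw [show ((L + 1 - 1 - k : ℕ) : ℤ) = L - k by omega]
  unfold ee CC
  rw [show (L:ℤ) - (L - k) = k by ring, show (L:ℤ) + r - (L - k) = k + r by ring,
    show (L:ℤ) + (L + r) - 2 * (L - k) = 2 * k + r by ring,
    show (L:ℤ) + n - (L - k) = k + n by ring,
    show (L:ℤ) + n - 1 - (L - k) = k + n - 1 by ring, invQ_nat]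
  ring

lemma conv_tend {q : ℂ} (hq : ‖q‖ < 1) (n r : ℤ) :
    Tendsto (fun L : ℕ => ∑ k ∈ Finset.range (L+1), invQ q ((L:ℤ) - k) * CC q n r k) atTop
      (𝓝 ((qPInf q q)⁻¹ * ∑' k, CC q n r k)) := by
  obtain ⟨K, h0, hK⟩ := invQ_bd hq
  rw [← tsum_mul_left]
  have := tendsto_tsum_of_dominated_convergence (𝓕 := atTop)
    (f := fun (L : ℕ) (i : ℕ) => invQ q ((L:ℤ) - i) * CC q n r i)
    (g := fun i => (qPInf q q)⁻¹ * CC q n r i)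
    (bound := fun i : ℕ => K * ‖CC q n r i‖)
    ((CC_summable hq n r).norm.mul_left _) ?_ ?_
  · refine this.congr fun L => ?_
    refine tsum_eq_sum fun i hi => ?_
    rw [invQ_neg q (show (L:ℤ) - i < 0 by simp at hi; omega)]; simp
  · intro i
    have h1 := (invQ_tend hq (-(i:ℤ))).mul_const (CC q n r i)
    simpa only [← sub_eq_add_neg] using h1
  · refine Eventually.of_forall fun L i => ?_
    simp only [norm_mul]
    gcongr
    apply hK

lemma AA_diff {q : ℂ} (hq : ‖q‖ < 1) (n r : ℤ) (L : ℕ) :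
    AA q L (L + r) (L + n) - AA q L (L + r) (L + n - 1)
    = (∑ i ∈ Finset.range (L+1),
      invQ q i * invQ q ((L:ℤ) - i) * invQ q (n + i) * invQ q ((L:ℤ) + (r - n + 1) - i) * uu q (n + i))
      - ∑ i ∈ Finset.range (L+1),
      invQ q i * invQ q ((L:ℤ) - i) * invQ q (r - n + 1 + i) * invQ q ((L:ℤ) + n - i)
        * uu q (r - n + 1 + i) := by
  rw [← Finset.sum_range_reflect (n := L + 1) (f := fun i : ℕ =>
    invQ q i * invQ q ((L:ℤ) - i) * invQ q (n + i) * invQ q ((L:ℤ) + (r - n + 1) - i) * uu q (n + i))]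
  unfold AA
  rw [← Finset.sum_sub_distrib, ← Finset.sum_sub_distrib]
  refine Finset.sum_congr rfl fun k hk => ?_
  have hk' : k ≤ L := by simpa [Nat.lt_succ_iff] using hk
  rw [show ((L + 1 - 1 - k : ℕ) : ℤ) = L - k by omega]
  have h := bet_diff hq (L + r) (L + n - k)
  rw [show (L:ℤ) + n - 1 - k = L + n - k - 1 by ring, ← mul_sub, h]
  unfold bet
  rw [show (L:ℤ) - (L - k) = k by ring, show n + ((L:ℤ) - k) = L + n - k by ring,
    show (L:ℤ) + (r - n + 1) - (L - k) = r - n + 1 + k by ring,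
    show (L:ℤ) + r - (L + n - k) + 1 = r - n + 1 + k by ring]
  ring

/-- Lemma 3.5 (Lemma `lem2` of the paper). -/
theorem binomial_difference_sum (n r : ℤ) (q : ℂ) (hq : ‖q‖ < 1) :
    (∑' L : ℕ,
      (qBinI q (2 * (L : ℤ) + r) ((L : ℤ) + n) - qBinI q (2 * (L : ℤ) + r) ((L : ℤ) + n - 1)) *
        ((qP q q L)⁻¹ * invQ q ((L : ℤ) + r)))
    = (qPInf q q)⁻¹ *
        ∑' j : ℕ,
          (q ^ (j : ℕ) * ((qP q q j)⁻¹ * invQ q ((j : ℤ) - n))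
            - q ^ (j : ℕ) * ((qP q q j)⁻¹ * invQ q ((j : ℤ) + n - r - 1))) := by
  have h1 := conv_tend hq n r
  have h2 := (T_tend hq n (r - n + 1)).sub (T_tend hq (r - n + 1) n)
  have h3 := h2.congr' (f₂ := fun L : ℕ => ∑ k ∈ Finset.range (L+1), invQ q ((L:ℤ) - k) * CC q n r k) (by
    filter_upwards [eventually_ge_atTop r.natAbs] with L hL
    rw [← conv_eq hq n r L (by omega), AA_diff hq])
  have h4 := tendsto_nhds_unique h1 h3
  have hne := inv_ne_zero (qPInf_ne hq)
  rw [mul_assoc, mul_assoc, ← mul_sub] at h4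
  have h5 := mul_left_cancel₀ hne h4
  have hr : ∀ j : ℕ, (j:ℤ) + n - r - 1 = j - (r - n + 1) := fun j => by ring
  simp only [hr]
  rw [(RT_summable hq n).tsum_sub (RT_summable hq (r - n + 1)), ← GTerm_tsum, ← GTerm_tsum, mul_sub]
  exact h5
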